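/- Let r ≥ 2 and k ≥ 1 be integers and let n be sufficiently large. Fix a cyclic ordering σ ∈ Q_n and integers 1 ≤ s ≤ b. Then the number of subhypergraphs of H_σ with exactly b edges and exactly s connected components is at most binom(n, s) · binom(b-1, s-1) · e^b · r^{2b} · binom(k+r-2, r-1)^b. -/

import Mathlib

open scoped Classical
open Finset

noncomputable section

/-- The window of `k+r-1` cyclically consecutive vertices starting at position `i`,
under the cyclic ordering `σ`. -/
def cycWindow (k r n : ℕ) (σ : ZMod n → Fin n) (i : ZMod n) : Finset (Fin n) :=
  (Finset.range (k + r - 1)).image fun j => σ (i + (j : ZMod n))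

/-- The edge set of the `k`th power of a tight Hamilton cycle on `[n]` associated with
the cyclic ordering `σ`: all `r`-sets contained in some window of `k+r-1`
cyclically consecutive vertices. -/
def hamPowEdges (r k n : ℕ) (σ : ZMod n → Fin n) : Finset (Finset (Fin n)) :=
  Finset.univ.filter fun e => e.card = r ∧ ∃ i : ZMod n, e ⊆ cycWindow k r n σ i

/-- All `r`-element subsets of `Fin n`. -/
def rSets (n r : ℕ) : Finset (Finset (Fin n)) := Finset.univ.filter fun e => e.card = r

/-- The probability weight of a given `r`-graph `H` in the binomial random
`r`-graph `H^{(r)}(n,p)`. -/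
def prW (n r : ℕ) (p : ℝ) (H : Finset (Finset (Fin n))) : ℝ :=
  p ^ H.card * (1 - p) ^ ((rSets n r).card - H.card)

/-- The probability that `H^{(r)}(n,p)` satisfies the property `A`. -/
def probOf (n r : ℕ) (p : ℝ) (A : Finset (Finset (Fin n)) → Prop) : ℝ :=
  ∑ H ∈ (rSets n r).powerset, if A H then prW n r p H else 0

/-- The expectation of `f` with respect to the random `r`-graph `H^{(r)}(n,p)`. -/
def expct (n r : ℕ) (p : ℝ) (f : Finset (Finset (Fin n)) → ℝ) : ℝ :=
  ∑ H ∈ (rSets n r).powerset, prW n r p H * f H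

/-- `H` contains (a spanning copy of) the `k`th power of a tight Hamilton cycle. -/
def containsHamPow (r k n : ℕ) (H : Finset (Finset (Fin n))) : Prop :=
  ∃ σ : ZMod n → Fin n, Function.Bijective σ ∧ hamPowEdges r k n σ ⊆ H

/-- Degree of a vertex in a hypergraph given by its edge set. -/
def degOf (n : ℕ) (H : Finset (Finset (Fin n))) (v : Fin n) : ℕ :=
  (H.filter fun e => v ∈ e).card

/-- The auxiliary graph on the edges of a hypergraph `P`, two edges being adjacent
iff they are distinct and share a vertex. -/
def edgeGraph {n : ℕ} (P : Finset (Finset (Fin n))) : SimpleGraph {e // e ∈ P} :=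
  SimpleGraph.fromRel fun e f => (e.1 ∩ f.1).Nonempty

/-- The number of connected components of the hypergraph with edge set `P`. -/
def numComp {n : ℕ} (P : Finset (Finset (Fin n))) : ℕ :=
  Nat.card (edgeGraph P).ConnectedComponent

/-- The set of vertices covered by the edges of `P`. -/
def vertsOf {n : ℕ} (P : Finset (Finset (Fin n))) : Finset (Fin n) := P.biUnion id

/-- `σ` is the canonical representative of a cyclic ordering of `[n]`
(a permutation considered up to rotation and reflection). -/
def IsCycRep (n : ℕ) (σ : ZMod n → Fin n) : Prop :=
  Function.Bijective σ ∧ (σ 0).val = 0 ∧ (σ 1).val < (σ (-1)).val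

/-- `|Q_n|`, the number of cyclic orderings of `[n]`. -/
def QCard (n : ℕ) : ℕ := Nat.card {σ : ZMod n → Fin n // IsCycRep n σ}

/-- `N_σ(b)`: the number of cyclic orderings `τ ∈ Q_n` such that `H_σ` and `H_τ`
share exactly `b` edges. -/
def NQ (r k n : ℕ) (σ : ZMod n → Fin n) (b : ℕ) : ℕ :=
  Nat.card {τ : ZMod n → Fin n //
    IsCycRep n τ ∧ (hamPowEdges r k n σ ∩ hamPowEdges r k n τ).card = b}

/-- `N_σ(b,s)`: the number of cyclic orderings `τ ∈ Q_n` such that `H_σ ∩ H_τ`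
has exactly `b` edges and exactly `s` connected components. -/
def NQs (r k n : ℕ) (σ : ZMod n → Fin n) (b s : ℕ) : ℕ :=
  Nat.card {τ : ZMod n → Fin n //
    IsCycRep n τ ∧ (hamPowEdges r k n σ ∩ hamPowEdges r k n τ).card = b ∧
      numComp (hamPowEdges r k n σ ∩ hamPowEdges r k n τ) = s}

/-- The random variable `X`: the number of cyclic orderings `σ ∈ Q_n` with `H_σ ⊆ H`. -/
def XH (r k n : ℕ) (H : Finset (Finset (Fin n))) : ℝ :=
  Nat.card {σ : ZMod n → Fin n // IsCycRep n σ ∧ hamPowEdges r k n σ ⊆ H}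

/-- The auxiliary graph on a finite set `P` of edges of a simple graph, two edges
being adjacent iff they are distinct and share a vertex. -/
def edgeGraphS {V : Type*} (P : Finset (Sym2 V)) : SimpleGraph {e // e ∈ P} :=
  SimpleGraph.fromRel fun e f => ∃ x, x ∈ e.1 ∧ x ∈ f.1

/-- The members of `E \ P` that meet some member of `P`. -/
def edgeBoundary {n : ℕ} (E P : Finset (Finset (Fin n))) : Finset (Finset (Fin n)) :=
  (E \ P).filter fun f => ∃ e ∈ P, (e ∩ f).Nonempty

/-- The vertices of `S` are covered by `P`, and every component of `P` meets `S`. -/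
def IsRooted {n : ℕ} (S : Finset (Fin n)) (P : Finset (Finset (Fin n))) : Prop :=
  (∀ v ∈ S, ∃ f ∈ P, v ∈ f) ∧
    ∀ e : {e // e ∈ P}, ∃ v ∈ S, ∃ f : {e // e ∈ P}, v ∈ f.1 ∧ (edgeGraph P).Reachable f e

/-- If `P ⊆ ω` is rooted at `S`, then `P` is contained in every `P'` that covers `S` and whose
boundary avoids `ω`. -/
lemma IsRooted.subset {n : ℕ} {S : Finset (Fin n)} {E P P' ω : Finset (Finset (Fin n))}
    (hP : IsRooted S P) (hP' : IsRooted S P') (hω : ω ⊆ E) (hPω : P ⊆ ω)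
    (hd : Disjoint ω (edgeBoundary E P')) : P ⊆ P' := by
  have key : ∀ e ∈ P', ∀ f ∈ P, (e ∩ f).Nonempty → f ∈ P' := by
    intro e he f hf hef
    by_contra hfP'
    refine Finset.disjoint_left.1 hd (hPω hf) ?_
    simp only [edgeBoundary, mem_filter, mem_sdiff]
    exact ⟨⟨hω (hPω hf), hfP'⟩, e, he, hef⟩
  intro e he
  obtain ⟨v, hv, f, hvf, hfe⟩ := hP.2 ⟨e, he⟩
  obtain ⟨g, hg, hvg⟩ := hP'.1 v hv
  have hf : f.1 ∈ P' := key g hg f.1 f.2 ⟨v, mem_inter.2 ⟨hvg, hvf⟩⟩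
  obtain ⟨w⟩ := hfe
  have walk : ∀ {a c : {e // e ∈ P}}, (edgeGraph P).Walk a c → a.1 ∈ P' → c.1 ∈ P' := by
    intro a c w
    induction w with
    | nil => exact id
    | cons h _ ih =>
      intro ha
      apply ih
      rw [edgeGraph, SimpleGraph.fromRel_adj] at h
      rcases h.2 with h | h
      · exact key _ ha _ (Subtype.prop _) h
      · exact key _ ha _ (Subtype.prop _) (by rwa [inter_comm] at h)
  exact walk w hf

/-- The probability that a random subset of `E` contains `P` and avoids `B`. -/
lemma sum_weight_union {α : Type*} [DecidableEq α] {E P B : Finset α} (hP : P ⊆ E) (hB : B ⊆ E \ P)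
    {p q : ℝ} (hpq : p + q = 1) :
    ∑ ω ∈ ((E \ P) \ B).powerset.image (P ∪ ·), p ^ #ω * q ^ (#E - #ω) = p ^ #P * q ^ #B := by
  have hdis : ∀ η ∈ ((E \ P) \ B).powerset, Disjoint P η := fun η hη =>
    Finset.disjoint_of_subset_right ((mem_powerset.1 hη).trans sdiff_subset) disjoint_sdiff
  rw [sum_image]
  · have hcard : #E = #P + (#B + #((E \ P) \ B)) := by
      have h1 := card_sdiff_add_card_eq_card hP
      have h2 := card_sdiff_add_card_eq_card hB
      omega
    have : ∀ η ∈ ((E \ P) \ B).powerset, p ^ #(P ∪ η) * q ^ (#E - #(P ∪ η))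
        = p ^ #P * q ^ #B * (p ^ #η * q ^ (#((E \ P) \ B) - #η)) := by
      intro η hη
      have hle := card_le_card (mem_powerset.1 hη)
      rw [card_union_of_disjoint (hdis η hη), hcard,
        show #P + (#B + #((E \ P) \ B)) - (#P + #η) = #B + (#((E \ P) \ B) - #η) by omega]
      ring
    rw [sum_congr rfl this, ← mul_sum, sum_pow_mul_eq_add_pow, hpq, one_pow, mul_one]
  · intro η hη η' hη' h
    have h' : P ∪ η = P ∪ η' := h
    rw [← union_sdiff_cancel_left (hdis η hη), h', union_sdiff_cancel_left (hdis η' hη')]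

/-- In a random subset of `E`, the events that the cluster of `S` equals a given set are
disjoint, so their probabilities sum to at most one. -/
lemma sum_isRooted_le_one {n : ℕ} (S : Finset (Fin n)) (E : Finset (Finset (Fin n)))
    {p q : ℝ} (hp : 0 ≤ p) (hq : 0 ≤ q) (hpq : p + q = 1) :
    ∑ P ∈ E.powerset.filter (IsRooted S), p ^ #P * q ^ #(edgeBoundary E P) ≤ 1 := by
  have hsub : ∀ P ∈ E.powerset.filter (IsRooted S),
      ∀ ω ∈ ((E \ P) \ edgeBoundary E P).powerset.image (P ∪ ·),
        ω ⊆ E ∧ P ⊆ ω ∧ Disjoint ω (edgeBoundary E P) := by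
    intro P hP ω hω
    obtain ⟨η, hη, rfl⟩ := mem_image.1 hω
    have hPE := mem_powerset.1 (mem_filter.1 hP).1
    have hη := mem_powerset.1 hη
    refine ⟨union_subset hPE (hη.trans (sdiff_subset.trans sdiff_subset)), subset_union_left, ?_⟩
    rw [disjoint_union_left]
    exact ⟨Finset.disjoint_of_subset_right (filter_subset _ _) disjoint_sdiff,
      Finset.disjoint_of_subset_left hη sdiff_disjoint⟩
  calc ∑ P ∈ E.powerset.filter (IsRooted S), p ^ #P * q ^ #(edgeBoundary E P)
      = ∑ P ∈ E.powerset.filter (IsRooted S),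
          ∑ ω ∈ ((E \ P) \ edgeBoundary E P).powerset.image (P ∪ ·),
            p ^ #ω * q ^ (#E - #ω) :=
        sum_congr rfl fun P hP => (sum_weight_union (mem_powerset.1 (mem_filter.1 hP).1)
          (filter_subset _ _) hpq).symm
    _ = ∑ ω ∈ (E.powerset.filter (IsRooted S)).biUnion fun P =>
          ((E \ P) \ edgeBoundary E P).powerset.image (P ∪ ·), p ^ #ω * q ^ (#E - #ω) := by
        rw [sum_biUnion]
        intro P hP P' hP' hne
        refine Finset.disjoint_left.2 fun ω hω hω' => hne ?_
        obtain ⟨h1, h2, h3⟩ := hsub P hP ω hω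
        obtain ⟨-, h2', h3'⟩ := hsub P' hP' ω hω'
        have hR := (mem_filter.1 hP).2
        have hR' := (mem_filter.1 hP').2
        exact (hR.subset hR' h1 h2 h3').antisymm (hR'.subset hR h1 h2' h3)
    _ ≤ ∑ ω ∈ E.powerset, p ^ #ω * q ^ (#E - #ω) := by
        refine sum_le_sum_of_subset_of_nonneg ?_ fun _ _ _ => by positivity
        exact biUnion_subset.2 fun P hP ω hω => mem_powerset.2 (hsub P hP ω hω).1
    _ = 1 := by rw [sum_pow_mul_eq_add_pow, hpq, one_pow]

lemma one_le_exp_one_mul_one_sub_inv_pow (d : ℕ) :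
    1 ≤ Real.exp 1 * (1 - ((d : ℝ) + 1)⁻¹) ^ d := by
  rcases Nat.eq_zero_or_pos d with rfl | hd
  · simp
  have hd' : (0 : ℝ) < d := by exact_mod_cast hd
  have h1 : (1 + (d : ℝ)⁻¹) ^ d ≤ Real.exp 1 := by
    calc (1 + (d : ℝ)⁻¹) ^ d ≤ Real.exp ((d : ℝ)⁻¹) ^ d := by
          gcongr
          linarith [Real.add_one_le_exp ((d : ℝ)⁻¹)]
      _ = Real.exp 1 := by rw [← Real.exp_nat_mul, mul_inv_cancel₀ hd'.ne']
  have h2 : (1 + (d : ℝ)⁻¹) * (1 - ((d : ℝ) + 1)⁻¹) = 1 := by field_simp; ring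
  have h3 : (0 : ℝ) ≤ 1 - ((d : ℝ) + 1)⁻¹ := by
    rw [sub_nonneg]
    exact inv_le_one_of_one_le₀ (by linarith)
  calc (1 : ℝ) = (1 + (d : ℝ)⁻¹) ^ d * (1 - ((d : ℝ) + 1)⁻¹) ^ d := by
        rw [← mul_pow, h2, one_pow]
    _ ≤ _ := by gcongr

lemma card_edgeBoundary_le {n : ℕ} {E P : Finset (Finset (Fin n))} {d : ℕ} (hP : P ⊆ E)
    (hne : ∀ e ∈ E, e.Nonempty)
    (hd : ∀ e ∈ E, #(E.filter fun f => (e ∩ f).Nonempty) ≤ d + 1) :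
    #(edgeBoundary E P) ≤ #P * d := by
  have : edgeBoundary E P ⊆ P.biUnion fun e => (E.filter fun f => (e ∩ f).Nonempty).erase e := by
    intro f hf
    simp only [edgeBoundary, mem_filter, mem_sdiff] at hf
    obtain ⟨⟨hfE, hfP⟩, e, he, hef⟩ := hf
    simp only [mem_biUnion, mem_erase, mem_filter]
    exact ⟨e, he, fun h => hfP (h ▸ he), hfE, hef⟩
  refine (card_le_card this).trans (card_biUnion_le_card_mul _ _ _ fun e he => ?_)
  have heE := hP he
  rw [card_erase_of_mem (by simp [heE, hne e heE])]
  exact Nat.sub_le_of_le_add (hd e heE)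

/-- The number of rooted sets of `b` edges, when every edge meets at most `d` other edges. -/
lemma card_isRooted_le {n : ℕ} (S : Finset (Fin n)) {E : Finset (Finset (Fin n))} {d : ℕ}
    (hne : ∀ e ∈ E, e.Nonempty)
    (hd : ∀ e ∈ E, #(E.filter fun f => (e ∩ f).Nonempty) ≤ d + 1) (b : ℕ) :
    (#(E.powerset.filter fun P => #P = b ∧ IsRooted S P) : ℝ)
      ≤ (Real.exp 1 * ((d : ℝ) + 1)) ^ b := by
  set p : ℝ := ((d : ℝ) + 1)⁻¹ with hp
  have hp0 : 0 < p := by positivity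
  have hp1 : p ≤ 1 := inv_le_one_of_one_le₀ (by linarith [Nat.cast_nonneg (α := ℝ) d])
  have hq0 : 0 ≤ 1 - p := by linarith
  have hsum := sum_isRooted_le_one S E hp0.le hq0 (by ring : p + (1 - p) = 1)
  have hle : (#(E.powerset.filter fun P => #P = b ∧ IsRooted S P) : ℝ) *
      (p * (1 - p) ^ d) ^ b ≤ 1 := by
    refine le_trans ?_ hsum
    rw [← nsmul_eq_mul, ← sum_const]
    refine (sum_le_sum fun P hP => ?_).trans (sum_le_sum_of_subset_of_nonneg
      (f := fun P => p ^ #P * (1 - p) ^ #(edgeBoundary E P)) ?_ fun _ _ _ => by positivity)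
    · simp only [mem_filter, mem_powerset] at hP
      obtain ⟨hPE, rfl, -⟩ := hP
      rw [mul_pow, ← pow_mul, mul_comm d]
      gcongr ?_ * ?_
      exact pow_le_pow_of_le_one hq0 (by linarith) (card_edgeBoundary_le hPE hne hd)
    · intro P hP
      simp only [mem_filter] at hP ⊢
      exact ⟨hP.1, hP.2.2⟩
  have hone : 1 ≤ (Real.exp 1 * ((d : ℝ) + 1)) * (p * (1 - p) ^ d) := by
    have : (Real.exp 1 * ((d : ℝ) + 1)) * (p * (1 - p) ^ d) = Real.exp 1 * (1 - p) ^ d := by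
      rw [hp]; field_simp
    rw [this]
    exact one_le_exp_one_mul_one_sub_inv_pow d
  calc (#(E.powerset.filter fun P => #P = b ∧ IsRooted S P) : ℝ)
      ≤ #(E.powerset.filter fun P => #P = b ∧ IsRooted S P) *
          ((Real.exp 1 * ((d : ℝ) + 1)) * (p * (1 - p) ^ d)) ^ b :=
        le_mul_of_one_le_right (by positivity) (one_le_pow₀ hone)
    _ = (#(E.powerset.filter fun P => #P = b ∧ IsRooted S P) * (p * (1 - p) ^ d) ^ b) *
          (Real.exp 1 * ((d : ℝ) + 1)) ^ b := by rw [mul_pow _ (p * _)]; ring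
    _ ≤ _ := mul_le_of_le_one_left (by positivity) hle

/-- A hypergraph with `s` components is rooted at some set of `s` vertices. -/
lemma exists_isRooted {n : ℕ} {P : Finset (Finset (Fin n))} (hne : ∀ e ∈ P, e.Nonempty) :
    ∃ S : Finset (Fin n), #S = numComp P ∧ IsRooted S P := by
  choose v hv using fun c : (edgeGraph P).ConnectedComponent => hne c.out.1 c.out.2
  have hout : ∀ c : (edgeGraph P).ConnectedComponent,
      (edgeGraph P).connectedComponentMk c.out = c := fun c => Quot.out_eq c
  have hinj : Function.Injective v := by
    intro c c' h
    rw [← hout c, ← hout c']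
    by_cases hcc : c.out = c'.out
    · rw [hcc]
    · refine SimpleGraph.ConnectedComponent.sound (SimpleGraph.Adj.reachable ?_)
      exact (SimpleGraph.fromRel_adj _ _ _).2 ⟨hcc, Or.inl ⟨v c, mem_inter.2 ⟨hv c, h ▸ hv c'⟩⟩⟩
  refine ⟨univ.image v, ?_, ?_, ?_⟩
  · rw [card_image_of_injective _ hinj, numComp, Nat.card_eq_fintype_card, card_univ]
  · intro x hx
    obtain ⟨c, -, rfl⟩ := mem_image.1 hx
    exact ⟨_, c.out.2, hv c⟩
  · intro e
    refine ⟨v ((edgeGraph P).connectedComponentMk e), mem_image_of_mem _ (mem_univ _),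
      _, hv _, ?_⟩
    exact SimpleGraph.ConnectedComponent.exact (hout _)

lemma card_powersetCard_range_filter_zero_mem_le (m r : ℕ) :
    #((powersetCard (r + 1) (range (m + 1))).filter (0 ∈ ·)) ≤ m.choose r := by
  have : (powersetCard (r + 1) (range (m + 1))).filter (0 ∈ ·) ⊆
      (powersetCard r ((range (m + 1)).erase 0)).image (insert 0) := by
    intro J hJ
    obtain ⟨hJ, h0⟩ := mem_filter.1 hJ
    obtain ⟨hJs, hJc⟩ := mem_powersetCard.1 hJ
    refine mem_image.2 ⟨J.erase 0, mem_powersetCard.2 ⟨erase_subset_erase _ hJs, ?_⟩,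
      insert_erase h0⟩
    rw [card_erase_of_mem h0, hJc, Nat.add_sub_cancel]
  refine (card_le_card this).trans (card_image_le.trans ?_)
  rw [card_powersetCard, card_erase_of_mem (by simp), card_range, Nat.add_sub_cancel]

lemma mem_cycWindow_iff {k r n : ℕ} {σ : ZMod n → Fin n} {i : ZMod n} {v : Fin n} :
    v ∈ cycWindow k r n σ i ↔ ∃ j : ℕ, j < k + r - 1 ∧ σ (i + j) = v := by
  simp [cycWindow]

/-- Every edge of `H_σ` has a first vertex, and all its vertices lie within the window starting
there. -/
lemma exists_anchor_of_mem_hamPowEdges {r k n : ℕ} (hr : 1 ≤ r) (hn : k + r ≤ n)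
    {σ : ZMod n → Fin n} (hσ : Function.Injective σ) {e : Finset (Fin n)}
    (he : e ∈ hamPowEdges r k n σ) :
    ∃ a : ZMod n, ∃ J ∈ powersetCard r (range (k + r - 1)), 0 ∈ J ∧
      J.image (fun j : ℕ => σ (a + j)) = e := by
  obtain ⟨-, hcard, i, hi⟩ := mem_filter.1 he
  have hex : ∃ j : ℕ, j < k + r - 1 ∧ σ (i + j) ∈ e := by
    obtain ⟨v, hv⟩ := card_pos.1 (by omega : 0 < #e)
    obtain ⟨j, hj, rfl⟩ := mem_cycWindow_iff.1 (hi hv)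
    exact ⟨j, hj, hv⟩
  obtain ⟨hj0, hj0e⟩ := Nat.find_spec hex
  have hmin : ∀ j, j < k + r - 1 → σ (i + j) ∈ e → Nat.find hex ≤ j :=
    fun j h1 h2 => Nat.find_min' hex ⟨h1, h2⟩
  generalize Nat.find hex = j₀ at *
  set a : ZMod n := i + j₀
  have hinj : Set.InjOn (fun j : ℕ => σ (a + j)) (range (k + r - 1) : Finset ℕ) := by
    intro x hx y hy hxy
    have hxy := add_left_cancel (hσ hxy)
    have hx := mem_range.1 (mem_coe.1 hx)
    have hy := mem_range.1 (mem_coe.1 hy)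
    rw [ZMod.natCast_eq_natCast_iff'] at hxy
    rwa [Nat.mod_eq_of_lt (by omega), Nat.mod_eq_of_lt (by omega)] at hxy
  have himg : ((range (k + r - 1)).filter fun j : ℕ => σ (a + j) ∈ e).image
      (fun j : ℕ => σ (a + j)) = e := by
    ext v
    simp only [mem_image, mem_filter]
    constructor
    · rintro ⟨j, ⟨-, h⟩, rfl⟩
      exact h
    · intro hv
      obtain ⟨j, hj, rfl⟩ := mem_cycWindow_iff.1 (hi hv)
      have hle := hmin j hj hv
      have heq : a + ((j - j₀ : ℕ) : ZMod n) = i + j := by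
        rw [Nat.cast_sub hle]
        simp only [a]
        ring
      exact ⟨j - j₀, ⟨mem_range.2 (by omega), by rwa [heq]⟩, by rw [heq]⟩
  refine ⟨a, (range (k + r - 1)).filter fun j : ℕ => σ (a + j) ∈ e,
    mem_powersetCard.2 ⟨filter_subset _ _, ?_⟩, ?_, himg⟩
  · rw [← card_image_of_injOn (hinj.mono (coe_subset.2 (filter_subset _ _))), himg, hcard]
  · simp only [mem_filter, mem_range, Nat.cast_zero, add_zero]
    exact ⟨by omega, hj0e⟩

lemma degOf_hamPowEdges_le {r k n : ℕ} (hr : 1 ≤ r) (hk : 1 ≤ k) (hn : k + r ≤ n)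
    {σ : ZMod n → Fin n} (hσ : Function.Bijective σ) (v : Fin n) :
    degOf n (hamPowEdges r k n σ) v ≤ r * (k + r - 2).choose (r - 1) := by
  obtain ⟨p, rfl⟩ := hσ.2 v
  set A := (powersetCard r (range (k + r - 1))).filter (0 ∈ ·) with hA
  have hsub : (hamPowEdges r k n σ).filter (fun e => σ p ∈ e) ⊆
      A.biUnion fun J => J.image fun j : ℕ => J.image fun l : ℕ => σ (p - j + l) := by
    intro e he
    obtain ⟨he, hpe⟩ := mem_filter.1 he
    obtain ⟨a, J, hJ, h0, rfl⟩ := exists_anchor_of_mem_hamPowEdges hr hn hσ.1 he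
    obtain ⟨j, hj, hja⟩ := mem_image.1 hpe
    refine mem_biUnion.2 ⟨J, mem_filter.2 ⟨hJ, h0⟩, mem_image.2 ⟨j, hj, ?_⟩⟩
    rw [← hσ.1 hja, add_sub_cancel_right]
  have hAcard : #A ≤ (k + r - 2).choose (r - 1) := by
    have := card_powersetCard_range_filter_zero_mem_le (k + r - 2) (r - 1)
    rwa [show r - 1 + 1 = r by omega, show k + r - 2 + 1 = k + r - 1 by omega] at this
  calc degOf n (hamPowEdges r k n σ) (σ p) ≤ _ := card_le_card hsub
    _ ≤ #A * r := card_biUnion_le_card_mul _ _ _ fun J hJ =>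
        card_image_le.trans (mem_powersetCard.1 (mem_filter.1 hJ).1).2.le
    _ ≤ (k + r - 2).choose (r - 1) * r := Nat.mul_le_mul_right _ hAcard
    _ = _ := mul_comm _ _

lemma card_filter_inter_nonempty_hamPowEdges_le {r k n : ℕ} (hr : 1 ≤ r) (hk : 1 ≤ k)
    (hn : k + r ≤ n) {σ : ZMod n → Fin n} (hσ : Function.Bijective σ) {e : Finset (Fin n)}
    (he : e ∈ hamPowEdges r k n σ) :
    #((hamPowEdges r k n σ).filter fun f => (e ∩ f).Nonempty)
      ≤ r ^ 2 * (k + r - 2).choose (r - 1) := by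
  have hsub : (hamPowEdges r k n σ).filter (fun f => (e ∩ f).Nonempty) ⊆
      e.biUnion fun v => (hamPowEdges r k n σ).filter fun f => v ∈ f := by
    intro f hf
    obtain ⟨hf, v, hv⟩ := mem_filter.1 hf
    obtain ⟨hve, hvf⟩ := mem_inter.1 hv
    exact mem_biUnion.2 ⟨v, hve, mem_filter.2 ⟨hf, hvf⟩⟩
  calc _ ≤ _ := card_le_card hsub
    _ ≤ #e * (r * (k + r - 2).choose (r - 1)) := card_biUnion_le_card_mul _ _ _ fun v _ =>
        degOf_hamPowEdges_le hr hk hn hσ v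
    _ = _ := by rw [(mem_filter.1 he).2.1]; ring

theorem stmt11 (r k : ℕ) (hr : 2 ≤ r) (hk : 1 ≤ k) :
    ∃ N : ℕ, ∀ n ≥ N, ∀ σ : ZMod n → Fin n, IsCycRep n σ →
      ∀ b s : ℕ, 1 ≤ s → s ≤ b →
        (((hamPowEdges r k n σ).powerset.filter fun P =>
            P.card = b ∧ numComp P = s).card : ℝ)
          ≤ (n.choose s : ℝ) * ((b - 1).choose (s - 1)) * Real.exp 1 ^ b *
              (r : ℝ) ^ (2 * b) * (((k + r - 2).choose (r - 1) : ℝ)) ^ b := by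
  refine ⟨k + r, fun n hn σ hσ b s hs hsb => ?_⟩
  set E := hamPowEdges r k n σ with hE
  set D := (k + r - 2).choose (r - 1) with hD
  have hD1 : 1 ≤ D := Nat.choose_pos (by omega)
  have hM : 1 ≤ r ^ 2 * D := Nat.mul_pos (by positivity) hD1
  have hne : ∀ e ∈ E, e.Nonempty := fun e he =>
    card_pos.1 (by rw [(mem_filter.1 he).2.1]; omega)
  have hd : ∀ e ∈ E, #(E.filter fun f => (e ∩ f).Nonempty) ≤ (r ^ 2 * D - 1) + 1 :=
    fun e he => (card_filter_inter_nonempty_hamPowEdges_le (by omega) hk hn hσ.1 he).trans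
      (Nat.sub_add_cancel hM).ge
  have hcast : ((r ^ 2 * D - 1 : ℕ) : ℝ) + 1 = (r : ℝ) ^ 2 * D := by
    rw [Nat.cast_sub hM]
    push_cast
    ring
  have hsub : (E.powerset.filter fun P => #P = b ∧ numComp P = s) ⊆
      (powersetCard s (univ : Finset (Fin n))).biUnion fun S =>
        E.powerset.filter fun P => #P = b ∧ IsRooted S P := by
    intro P hP
    obtain ⟨hPE, hPb, hPs⟩ := mem_filter.1 hP
    obtain ⟨S, hS, hroot⟩ := exists_isRooted fun e he => hne e (mem_powerset.1 hPE he)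
    exact mem_biUnion.2 ⟨S, mem_powersetCard.2 ⟨subset_univ _, hS.trans hPs⟩,
      mem_filter.2 ⟨hPE, hPb, hroot⟩⟩
  have hcomp : (1 : ℝ) ≤ (b - 1).choose (s - 1) := by
    exact_mod_cast Nat.choose_pos (by omega : s - 1 ≤ b - 1)
  calc (#(E.powerset.filter fun P => #P = b ∧ numComp P = s) : ℝ)
      ≤ ∑ S ∈ powersetCard s (univ : Finset (Fin n)),
          (#(E.powerset.filter fun P => #P = b ∧ IsRooted S P) : ℝ) := by
        exact_mod_cast (card_le_card hsub).trans card_biUnion_le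
    _ ≤ ∑ _S ∈ powersetCard s (univ : Finset (Fin n)), (Real.exp 1 * ((r : ℝ) ^ 2 * D)) ^ b :=
        sum_le_sum fun S _ => by
          rw [← hcast]
          exact card_isRooted_le S hne hd b
    _ = (n.choose s : ℝ) * 1 * Real.exp 1 ^ b * (r : ℝ) ^ (2 * b) * (D : ℝ) ^ b := by
        rw [sum_const, card_powersetCard, card_univ, Fintype.card_fin, nsmul_eq_mul, mul_pow,
          mul_pow, ← pow_mul]
        ring
    _ ≤ _ := by gcongr

end
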